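/- For every even n ∈ ℤ⁺, there is no RTAM system 𝒯 = (T, σ, 1) at temperature 1 with |dom σ| = 1 such that 𝒯 weakly (or strictly) self-assembles an n × n square. -/

import Mathlib

/-! # Reflexive Tile Assembly Model (RTAM) -/

/-- A glue: `none` is the null glue; `some (l, s)` has label `l : ℤ` and strength `s : ℕ`.
The complement of the label `l` is `-l`. -/
abbrev Glue : Type := Option (ℤ × ℕ)

/-- Strength with which two abutting glues bind: `s` if the labels are complementary and
the strengths are both equal to `s`, and `0` otherwise. -/
def glueBind : Glue → Glue → ℕ
  | some (l₁, s₁), some (l₂, s₂) => if l₂ = -l₁ ∧ s₂ = s₁ then s₁ else 0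
  | _, _ => 0

/-- Two abutting glues match (for mismatch-freeness): both null, or complementary labels
with equal strengths. -/
def GlueMatch (g h : Glue) : Prop :=
  (g = none ∧ h = none) ∨ ∃ l s, g = some (l, s) ∧ h = some (-l, s)

/-- A tile type: glues on the north, east, south and west sides (in that order). -/
abbrev TileType : Type := Glue × Glue × Glue × Glue

def TileType.north (t : TileType) : Glue := t.1
def TileType.east (t : TileType) : Glue := t.2.1
def TileType.south (t : TileType) : Glue := t.2.2.1
def TileType.west (t : TileType) : Glue := t.2.2.2

/-- A reflection `(h, v)`: `h` indicates a flip across the vertical axis (swapping east and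
west and negating `x`), `v` a flip across the horizontal axis (swapping north and south and
negating `y`).  `D = (false, false)`, `H = (true, false)`, `V = (false, true)`,
`B = (true, true)`. -/
abbrev Reflection : Type := Bool × Bool

/-- Composition of reflections (the Klein four-group). -/
def Reflection.comp (r s : Reflection) : Reflection := (xor r.1 s.1, xor r.2 s.2)

/-- The action of a reflection on a point of `ℤ²`. -/
def Reflection.onPoint (r : Reflection) (p : ℤ × ℤ) : ℤ × ℤ :=
  (if r.1 then -p.1 else p.1, if r.2 then -p.2 else p.2)

/-- The tile type obtained by reflecting `t` according to `r` (glues are unchanged, sides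
are permuted). -/
def TileType.reflect (t : TileType) (r : Reflection) : TileType :=
  (if r.2 then TileType.south t else TileType.north t,
   if r.1 then TileType.west t else TileType.east t,
   if r.2 then TileType.north t else TileType.south t,
   if r.1 then TileType.east t else TileType.west t)

/-- A placed tile: a tile type together with its reflection. -/
abbrev Placement : Type := TileType × Reflection

/-- An assembly: a partial function from `ℤ²` to placed tiles. -/
abbrev Assembly : Type := ℤ × ℤ → Option Placement

/-- The domain of an assembly. -/
def adom (α : Assembly) : Set (ℤ × ℤ) := {p | α p ≠ none}

/-- The glue presented by the placed tile `pl` at position `p` on the side facing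
position `q` (the null glue if `q` is not adjacent to `p`). -/
def facingGlue (pl : Placement) (p q : ℤ × ℤ) : Glue :=
  if q = (p.1 + 1, p.2) then TileType.east (TileType.reflect pl.1 pl.2)
  else if q = (p.1 - 1, p.2) then TileType.west (TileType.reflect pl.1 pl.2)
  else if q = (p.1, p.2 + 1) then TileType.north (TileType.reflect pl.1 pl.2)
  else if q = (p.1, p.2 - 1) then TileType.south (TileType.reflect pl.1 pl.2)
  else none

/-- The strength of the bond between the tiles of `α` at positions `p` and `q`. -/
def bondStrength (α : Assembly) (p q : ℤ × ℤ) : ℕ :=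
  match α p, α q with
  | some a, some b => glueBind (facingGlue a p q) (facingGlue b q p)
  | _, _ => 0

/-- Adjacency in the binding graph of `α`. -/
def BondAdj (α : Assembly) (p q : ℤ × ℤ) : Prop := 0 < bondStrength α p q

/-- `α` is `τ`-stable: every cut of its binding graph has total strength at least `τ`
(i.e. some finite set of crossing edges already has total strength at least `τ`). -/
def Stable (α : Assembly) (τ : ℕ) : Prop :=
  ∀ A : Set (ℤ × ℤ), A ⊆ adom α → A.Nonempty → (adom α \ A).Nonempty →
    ∃ E : Finset ((ℤ × ℤ) × (ℤ × ℤ)),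
      (∀ e ∈ E, e.1 ∈ A ∧ e.2 ∈ adom α \ A) ∧
      τ ≤ ∑ e ∈ E, bondStrength α e.1 e.2

/-- An RTAM tile assembly system: a finite tile set, a finite stable seed assembly, and a
temperature. -/
structure RTAS where
  tiles : Finset TileType
  seed : Assembly
  temp : ℕ
  seed_nonempty : (adom seed).Nonempty
  seed_finite : (adom seed).Finite
  seed_tiles : ∀ p pl, seed p = some pl → pl.1 ∈ tiles
  seed_stable : Stable seed temp

/-- `β` is obtained from `α` by `τ`-stably attaching a single tile (in any reflection) at
an empty position. -/
def Attaches (S : RTAS) (α β : Assembly) : Prop :=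
  ∃ (p : ℤ × ℤ) (t : TileType) (r : Reflection),
    α p = none ∧ t ∈ S.tiles ∧ β = Function.update α p (some (t, r)) ∧ Stable β S.temp

/-- Producible assemblies: those reachable from the seed in finitely many attachment steps
or in the limit. -/
def Producible (S : RTAS) (α : Assembly) : Prop :=
  ∃ f : ℕ → Assembly, f 0 = S.seed ∧
    (∀ n, f (n + 1) = f n ∨ Attaches S (f n) (f (n + 1))) ∧
    (∀ p pl, α p = some pl ↔ ∃ n, f n p = some pl)

/-- Terminal assemblies: producible assemblies admitting no further attachment. -/
def Terminal (S : RTAS) (α : Assembly) : Prop :=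
  Producible S α ∧ ∀ β, ¬ Attaches S α β

/-- Apply the reflection `r` and then the translation `v` to the assembly `α`. -/
def transform (α : Assembly) (r : Reflection) (v : ℤ × ℤ) : Assembly :=
  fun p => (α (Reflection.onPoint r (p - v))).map fun pl => (pl.1, Reflection.comp r pl.2)

/-- The configuration of an assembly: forget the reflections of the placed tiles. -/
def config (α : Assembly) : ℤ × ℤ → Option TileType := fun p => (α p).map Prod.fst

/-- A system is directed if any two producible assemblies have the same configuration up
to a reflection and a translation. -/
def RTASDirected (S : RTAS) : Prop :=
  ∀ α β, Producible S α → Producible S β →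
    ∃ (r : Reflection) (v : ℤ × ℤ), config (transform β r v) = config α

/-- A system is singly seeded if its seed consists of a single tile. -/
def SinglySeeded (S : RTAS) : Prop := ∃ p, adom S.seed = {p}

/-- `X` weakly self-assembles in `S`. -/
def WeaklySelfAssembles (S : RTAS) (X : Set (ℤ × ℤ)) : Prop :=
  ∃ B ⊆ S.tiles, ∀ α, Terminal S α →
    ∃ (r : Reflection) (v : ℤ × ℤ),
      {p | ∃ pl, transform α r v p = some pl ∧ pl.1 ∈ B} = X

/-- `X` strictly self-assembles in `S`. -/
def StrictlySelfAssembles (S : RTAS) (X : Set (ℤ × ℤ)) : Prop :=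
  ∀ α, Terminal S α →
    ∃ (r : Reflection) (v : ℤ × ℤ), adom (transform α r v) = X

/-- A semi-doubly periodic subset of `ℤ²`. -/
def SemiDoublyPeriodic (X : Set (ℤ × ℤ)) : Prop :=
  ∃ b u v : ℤ × ℤ, X = {p | ∃ n m : ℕ, p = b + (n : ℤ) • u + (m : ℤ) • v}

/-- A finite union of semi-doubly periodic sets. -/
def FiniteUnionSDP (X : Set (ℤ × ℤ)) : Prop :=
  ∃ (k : ℕ) (f : Fin k → Set (ℤ × ℤ)),
    (∀ i, SemiDoublyPeriodic (f i)) ∧ X = ⋃ i, f i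

/-- The box of radius `c` centered at `v`. -/
def box (c : ℕ) (v : ℤ × ℤ) : Set (ℤ × ℤ) :=
  {p | |p.1 - v.1| ≤ (c : ℤ) ∧ |p.2 - v.2| ≤ (c : ℤ)}

/-- The `n × m` rectangle `{0, …, n−1} × {0, …, m−1} ⊆ ℤ²`. -/
def rectShape (n m : ℕ) : Set (ℤ × ℤ) :=
  {p | 0 ≤ p.1 ∧ p.1 < (n : ℤ) ∧ 0 ≤ p.2 ∧ p.2 < (m : ℤ)}

/-- The `n × n` square `{0, …, n−1}² ⊆ ℤ²`. -/
def squareShape (n : ℕ) : Set (ℤ × ℤ) := rectShape n n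

/-- Grid adjacency on `ℤ²`. -/
def GridAdj (p q : ℤ × ℤ) : Prop := (p.1 - q.1).natAbs + (p.2 - q.2).natAbs = 1

/-- `X` is connected in the grid graph. -/
def GridConnectedOn (X : Set (ℤ × ℤ)) : Prop :=
  ∀ p ∈ X, ∀ q ∈ X, Relation.ReflTransGen (fun a b => GridAdj a b ∧ a ∈ X ∧ b ∈ X) p q

/-- A shape: a finite nonempty connected subset of `ℤ²`. -/
def IsShape (X : Set (ℤ × ℤ)) : Prop := X.Finite ∧ X.Nonempty ∧ GridConnectedOn X

/-- A system is mismatch-free: in every producible assembly, abutting sides of adjacent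
tiles are either both null or carry complementary glues of equal strength. -/
def MismatchFree (S : RTAS) : Prop :=
  ∀ α, Producible S α → ∀ p q a b, GridAdj p q → α p = some a → α q = some b →
    GlueMatch (facingGlue a p q) (facingGlue b q p)

/-- `X` is odd-symmetric with respect to some horizontal or vertical line through lattice
points. -/
def OddSymmetric (X : Set (ℤ × ℤ)) : Prop :=
  (∃ l : ℤ, ∀ a b : ℤ, ((a, l - b) ∈ X ↔ (a, l + b) ∈ X)) ∨
  (∃ l : ℤ, ∀ a b : ℤ, ((l - a, b) ∈ X ↔ (l + a, b) ∈ X))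

/-- The binding graph of `α` is a tree: connected on `adom α` and every edge is a bridge. -/
def BindingGraphIsTree (α : Assembly) : Prop :=
  (∀ p ∈ adom α, ∀ q ∈ adom α, Relation.ReflTransGen (BondAdj α) p q) ∧
  (∀ p q, BondAdj α p q →
    ¬ Relation.ReflTransGen
      (fun a b => BondAdj α a b ∧ ¬((a = p ∧ b = q) ∨ (a = q ∧ b = p))) p q)

/-- A spanning tree of the grid graph of a shape `X`. -/
structure TreeOf (X : Set (ℤ × ℤ)) where
  adj : ℤ × ℤ → ℤ × ℤ → Prop
  symm : ∀ p q, adj p q → adj q p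
  valid : ∀ p q, adj p q → p ∈ X ∧ q ∈ X ∧ GridAdj p q
  connected : ∀ p ∈ X, ∀ q ∈ X, Relation.ReflTransGen adj p q
  acyclic : ∀ p q, adj p q →
    ¬ Relation.ReflTransGen
      (fun a b => adj a b ∧ ¬((a = p ∧ b = q) ∨ (a = q ∧ b = p))) p q

/-- The vertex set of a horizontal axis at height `l` from `x₁` to `x₂`. -/
def hAxisSet (l x₁ x₂ : ℤ) : Set (ℤ × ℤ) := {p | p.2 = l ∧ x₁ ≤ p.1 ∧ p.1 ≤ x₂}

/-- The vertex set of a vertical axis at abscissa `l` from `y₁` to `y₂`. -/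
def vAxisSet (l y₁ y₂ : ℤ) : Set (ℤ × ℤ) := {p | p.1 = l ∧ y₁ ≤ p.2 ∧ p.2 ≤ y₂}

/-- A (maximal) horizontal axis of the tree `t`: consecutive vertices on the line `y = l`
joined by tree edges, not extendable on either end. -/
def IsHAxis {X : Set (ℤ × ℤ)} (t : TreeOf X) (l x₁ x₂ : ℤ) : Prop :=
  x₁ ≤ x₂ ∧ (∀ x, x₁ ≤ x → x ≤ x₂ → ((x, l) : ℤ × ℤ) ∈ X) ∧
  (∀ x, x₁ ≤ x → x < x₂ → t.adj (x, l) (x + 1, l)) ∧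
  ¬ t.adj (x₁ - 1, l) (x₁, l) ∧ ¬ t.adj (x₂, l) (x₂ + 1, l)

/-- A (maximal) vertical axis of the tree `t`. -/
def IsVAxis {X : Set (ℤ × ℤ)} (t : TreeOf X) (l y₁ y₂ : ℤ) : Prop :=
  y₁ ≤ y₂ ∧ (∀ y, y₁ ≤ y → y ≤ y₂ → ((l, y) : ℤ × ℤ) ∈ X) ∧
  (∀ y, y₁ ≤ y → y < y₂ → t.adj (l, y) (l, y + 1)) ∧
  ¬ t.adj (l, y₁ - 1) (l, y₁) ∧ ¬ t.adj (l, y₂) (l, y₂ + 1)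

/-- The union of the axial branches of `t` beginning from `v` relative to the axis `a`
(together with `v` itself): everything reachable from `v` through a neighbor not on `a`
without revisiting `v`. -/
def branch {X : Set (ℤ × ℤ)} (t : TreeOf X) (a : Set (ℤ × ℤ)) (v : ℤ × ℤ) :
    Set (ℤ × ℤ) :=
  {v} ∪ {p | ∃ w, t.adj v w ∧ w ∉ a ∧
    Relation.ReflTransGen (fun x y => t.adj x y ∧ x ≠ v ∧ y ≠ v) w p}

/-- The axial branches of `t` beginning from `v` are symmetric across the reflection `ρ`
(of `ℤ²` across the line of the axis `a`). -/
def BranchSymmetric {X : Set (ℤ × ℤ)} (t : TreeOf X) (a : Set (ℤ × ℤ))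
    (ρ : ℤ × ℤ → ℤ × ℤ) (v : ℤ × ℤ) : Prop :=
  (∀ p ∈ branch t a v, ρ p ∈ branch t a v) ∧
  (∀ p q, p ∈ branch t a v → q ∈ branch t a v → t.adj p q → t.adj (ρ p) (ρ q))

/-- `t` is off-by-one symmetric across the horizontal axis determined by `(l, x₁, x₂)`:
the branches from every vertex of the axis, except at most one, are symmetric across it. -/
def OffByOneH {X : Set (ℤ × ℤ)} (t : TreeOf X) (l x₁ x₂ : ℤ) : Prop :=
  ∃ v₀ : ℤ × ℤ, ∀ x, x₁ ≤ x → x ≤ x₂ → ((x, l) : ℤ × ℤ) ≠ v₀ →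
    BranchSymmetric t (hAxisSet l x₁ x₂) (fun p => (p.1, 2 * l - p.2)) (x, l)

/-- `t` is off-by-one symmetric across the vertical axis determined by `(l, y₁, y₂)`. -/
def OffByOneV {X : Set (ℤ × ℤ)} (t : TreeOf X) (l y₁ y₂ : ℤ) : Prop :=
  ∃ v₀ : ℤ × ℤ, ∀ y, y₁ ≤ y → y ≤ y₂ → ((l, y) : ℤ × ℤ) ≠ v₀ →
    BranchSymmetric t (vAxisSet l y₁ y₂) (fun p => (2 * l - p.1, p.2)) (l, y)

/-- A tree is ε-symmetric if it is off-by-one symmetric across each of its axes. -/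
def TreeOf.EpsSymmetric {X : Set (ℤ × ℤ)} (t : TreeOf X) : Prop :=
  (∀ l x₁ x₂, IsHAxis t l x₁ x₂ → OffByOneH t l x₁ x₂) ∧
  (∀ l y₁ y₂, IsVAxis t l y₁ y₂ → OffByOneV t l y₁ y₂)

/-- A shape is ε-symmetric if some spanning tree of its grid graph is ε-symmetric. -/
def EpsSymmetricShape (X : Set (ℤ × ℤ)) : Prop :=
  ∃ t : TreeOf X, TreeOf.EpsSymmetric t

/-- The `c`-scaling of a shape: replace each point by a `c × c` block. -/
def scaleShape (X : Set (ℤ × ℤ)) (c : ℕ) : Set (ℤ × ℤ) :=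
  {p | (Int.fdiv p.1 (c : ℤ), Int.fdiv p.2 (c : ℤ)) ∈ X}

/-- The assembly encoded by a finite list of placed tiles. -/
def listAssembly (L : List ((ℤ × ℤ) × Placement)) : Assembly :=
  fun p => (L.find? fun e => decide (e.1 = p)).map Prod.snd

/-! ### Directions -/

/-- A unit direction `(axis, sign)`: axis `false` is horizontal, `true` vertical; sign `true` is
positive. -/
abbrev Dir : Type := Bool × Bool

/-- The integer sign encoded by a Boolean. -/
def sgn (b : Bool) : ℤ := if b then 1 else -1

/-- The unit vector of a direction. -/
def Dir.vec (d : Dir) : ℤ × ℤ := if d.1 then (0, sgn d.2) else (sgn d.2, 0)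

/-- The opposite direction. -/
def Dir.opp (d : Dir) : Dir := (d.1, !d.2)

/-- The action of a reflection on directions. -/
def Reflection.act (r : Reflection) (d : Dir) : Dir := (d.1, xor d.2 (if d.1 then r.2 else r.1))

/-- The `c`-component of a pair of signs. -/
def signAt (t : Bool × Bool) (c : Bool) : Bool := if c then t.2 else t.1

/-- The direction along the axis of `d` pointing into the quadrant `t`. -/
def Dir.toward (t : Bool × Bool) (d : Dir) : Dir := (d.1, signAt t d.1)

/-- The `c`-coordinate of a point. -/
def coord (c : Bool) (p : ℤ × ℤ) : ℤ := if c then p.2 else p.1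

/-- The glue on the side `d` of an unreflected tile. -/
def TileType.side (t : TileType) : Dir → Glue
  | (false, true) => t.east
  | (false, false) => t.west
  | (true, true) => t.north
  | (true, false) => t.south

/-- The glue that a placed tile presents in direction `d`. -/
def glueAt (pl : Placement) (d : Dir) : Glue := TileType.side pl.1 (Reflection.act pl.2 d)

theorem Dir.vec_opp (d : Dir) : d.opp.vec = -d.vec := by
  revert d; decide

theorem facingGlue_add_vec (pl : Placement) (p : ℤ × ℤ) (d : Dir) :
    facingGlue pl p (p + d.vec) = glueAt pl d := by
  obtain ⟨t, r1, r2⟩ := pl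
  obtain ⟨x, y⟩ := p
  obtain ⟨c, s⟩ := d
  cases c <;> cases s <;> cases r1 <;> cases r2 <;>
    simp [facingGlue, Dir.vec, sgn, glueAt, Reflection.act, TileType.side, TileType.reflect,
      TileType.east, TileType.west, TileType.north, TileType.south, sub_eq_add_neg]

theorem facingGlue_from_add_vec (pl : Placement) (p : ℤ × ℤ) (d : Dir) :
    facingGlue pl (p + d.vec) p = glueAt pl d.opp := by
  have h := facingGlue_add_vec pl (p + d.vec) d.opp
  rwa [Dir.vec_opp, add_neg_cancel_right] at h

theorem glueBind_comm (g h : Glue) : glueBind g h = glueBind h g := by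
  rcases g with _ | ⟨l, s⟩ <;> rcases h with _ | ⟨l', s'⟩ <;> simp only [glueBind]
  by_cases h1 : l' = -l ∧ s' = s
  · obtain ⟨rfl, rfl⟩ := h1
    simp
  · rw [if_neg h1, if_neg]
    rintro ⟨rfl, rfl⟩
    exact h1 (by simp)

theorem bondStrength_comm (α : Assembly) (p q : ℤ × ℤ) :
    bondStrength α p q = bondStrength α q p := by
  unfold bondStrength
  cases α p <;> cases α q <;> simp [glueBind_comm]

theorem exists_of_bond {α : Assembly} {p q : ℤ × ℤ} (h : 0 < bondStrength α p q) :
    ∃ a b, α p = some a ∧ α q = some b := by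
  unfold bondStrength at h
  cases h1 : α p <;> cases h2 : α q <;> simp_all

theorem bond_add_vec_iff (α : Assembly) (p : ℤ × ℤ) (d : Dir) :
    0 < bondStrength α p (p + d.vec) ↔ ∃ a b, α p = some a ∧ α (p + d.vec) = some b ∧
      0 < glueBind (glueAt a d) (glueAt b d.opp) := by
  constructor
  · intro h
    obtain ⟨a, b, ha, hb⟩ := exists_of_bond h
    refine ⟨a, b, ha, hb, ?_⟩
    simpa only [bondStrength, ha, hb, facingGlue_add_vec, facingGlue_from_add_vec] using h
  · rintro ⟨a, b, ha, hb, h⟩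
    simpa only [bondStrength, ha, hb, facingGlue_add_vec, facingGlue_from_add_vec] using h

theorem exists_dir_of_bond {α : Assembly} {p q : ℤ × ℤ} (h : 0 < bondStrength α p q) :
    ∃ d : Dir, q = p + d.vec := by
  by_contra hn
  push Not at hn
  obtain ⟨a, b, ha, hb⟩ := exists_of_bond h
  have hg : facingGlue a p q = none := by
    obtain ⟨x, y⟩ := p
    have h1 := hn (false, true)
    have h2 := hn (false, false)
    have h3 := hn (true, true)
    have h4 := hn (true, false)
    simp only [Dir.vec, sgn] at h1 h2 h3 h4
    simp_all [facingGlue, sub_eq_add_neg]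
  simp [bondStrength, ha, hb, hg, glueBind] at h

/-! ### Stability and growth at temperature 1 -/

/-- `β` extends `α`. -/
def Extends (α β : Assembly) : Prop := ∀ p pl, α p = some pl → β p = some pl

theorem Extends.trans {α β γ : Assembly} (h : Extends α β) (h' : Extends β γ) : Extends α γ :=
  fun p pl hp => h' p pl (h p pl hp)

theorem Extends.bond {α β : Assembly} (h : Extends α β) {p q : ℤ × ℤ}
    (hb : 0 < bondStrength α p q) : 0 < bondStrength β p q := by
  obtain ⟨a, b, ha, hb'⟩ := exists_of_bond hb
  simpa only [bondStrength, ha, hb', h _ _ ha, h _ _ hb'] using hb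

theorem extends_update {α : Assembly} {p : ℤ × ℤ} (hp : α p = none) (pl : Placement) :
    Extends α (Function.update α p (some pl)) := by
  intro q x hq
  rw [Function.update_of_ne, hq]
  rintro rfl
  simp [hp] at hq

theorem stable_one_iff (α : Assembly) : Stable α 1 ↔
    ∀ A : Set (ℤ × ℤ), A ⊆ adom α → A.Nonempty → (adom α \ A).Nonempty →
      ∃ p ∈ A, ∃ q ∈ adom α \ A, 0 < bondStrength α p q := by
  refine forall_congr' fun A => imp_congr_right fun _ => imp_congr_right fun _ =>
    imp_congr_right fun _ => ?_
  constructor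
  · rintro ⟨E, hE, hs⟩
    obtain ⟨e, he, hne⟩ := Finset.exists_ne_zero_of_sum_ne_zero (by omega :
      ∑ e ∈ E, bondStrength α e.1 e.2 ≠ 0)
    exact ⟨e.1, (hE e he).1, e.2, (hE e he).2, Nat.pos_of_ne_zero hne⟩
  · rintro ⟨p, hp, q, hq, hb⟩
    exact ⟨{(p, q)}, by simpa using ⟨hp, hq⟩, by simpa using Nat.one_le_of_lt hb⟩

theorem adom_update (α : Assembly) (p : ℤ × ℤ) (pl : Placement) :
    adom (Function.update α p (some pl)) = insert p (adom α) := by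
  ext q
  by_cases h : q = p <;> simp [adom, Function.update_apply, h]

theorem stable_update {α : Assembly} (hs : Stable α 1) {p q : ℤ × ℤ} (hp : α p = none)
    (pl : Placement) (hq : α q ≠ none)
    (hb : 0 < bondStrength (Function.update α p (some pl)) q p) :
    Stable (Function.update α p (some pl)) 1 := by
  rw [stable_one_iff] at hs ⊢
  rw [adom_update]
  have hpα : p ∉ adom α := by simp [adom, hp]
  have hext := extends_update hp pl
  intro A hA hne hne'
  by_cases hpA : p ∈ A
  · by_cases hqA : q ∈ A
    · obtain ⟨x, hx, hxA⟩ := hne'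
      have hxα : x ∈ adom α := by
        rcases hx with rfl | hx
        · exact absurd hpA hxA
        · exact hx
      obtain ⟨a, ha, b, hb, hab⟩ := hs (A \ {p})
        (fun y hy => (hA hy.1).resolve_left hy.2)
        ⟨q, hqA, fun h => hpα (h ▸ hq)⟩ ⟨x, hxα, fun h => hxA h.1⟩
      refine ⟨a, ha.1, b, ⟨Or.inr hb.1, fun h => hb.2 ⟨h, ?_⟩⟩, hext.bond hab⟩
      rintro rfl
      exact hpα hb.1
    · exact ⟨p, hpA, q, ⟨Or.inr hq, hqA⟩, by rwa [bondStrength_comm]⟩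
  · by_cases hqA : q ∈ A
    · exact ⟨q, hqA, p, ⟨Or.inl rfl, hpA⟩, hb⟩
    · obtain ⟨a, ha, b, hb, hab⟩ := hs A
        (fun y hy => (hA hy).resolve_left fun h => hpA (h ▸ hy)) hne ⟨q, hq, hqA⟩
      exact ⟨a, ha, b, ⟨Or.inr hb.1, hb.2⟩, hext.bond hab⟩

/-- Reachability by finitely many attachments. -/
def Reachable (S : RTAS) (β : Assembly) : Prop := Relation.ReflTransGen (Attaches S) S.seed β

theorem Attaches.extends {S : RTAS} {α β : Assembly} (h : Attaches S α β) : Extends α β := by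
  obtain ⟨p, t, r, hp, -, rfl, -⟩ := h
  exact extends_update hp _

theorem Reachable.stable {S : RTAS} {β : Assembly} (h : Reachable S β) : Stable β S.temp := by
  induction h with
  | refl => exact S.seed_stable
  | tail _ h _ =>
    obtain ⟨_, _, _, _, _, rfl, h⟩ := h
    exact h

theorem Reachable.extends_seed {S : RTAS} {β : Assembly} (h : Reachable S β) :
    Extends S.seed β := by
  induction h with
  | refl => exact fun _ _ h => h
  | tail _ h ih => exact ih.trans h.extends

theorem Reachable.tiles {S : RTAS} {β : Assembly} (h : Reachable S β) {p : ℤ × ℤ}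
    {pl : Placement} (hp : β p = some pl) : pl.1 ∈ S.tiles := by
  induction h generalizing p pl with
  | refl => exact S.seed_tiles p pl hp
  | tail _ h ih =>
    obtain ⟨q, t, r, hq, ht, rfl, -⟩ := h
    by_cases hpq : p = q
    · subst hpq
      rw [Function.update_self, Option.some_inj] at hp
      exact hp ▸ ht
    · rw [Function.update_of_ne hpq] at hp
      exact ih hp

theorem attaches_of_bond {S : RTAS} (hS : S.temp = 1) {β : Assembly} (hβ : Stable β 1)
    {p q : ℤ × ℤ} {pl : Placement} (hp : β p = none) (hpl : pl.1 ∈ S.tiles) (hq : β q ≠ none)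
    (hb : 0 < bondStrength (Function.update β p (some pl)) q p) :
    Attaches S β (Function.update β p (some pl)) :=
  ⟨p, pl.1, pl.2, hp, hpl, rfl, hS ▸ stable_update hβ hp pl hq hb⟩

theorem Reachable.attach {S : RTAS} (hS : S.temp = 1) {β : Assembly} (hβ : Reachable S β)
    {q : ℤ × ℤ} {d : Dir} {a b : Placement} (hq : β q = some a) (he : β (q + d.vec) = none)
    (hb : b.1 ∈ S.tiles) (hg : 0 < glueBind (glueAt a d) (glueAt b d.opp)) :
    Reachable S (Function.update β (q + d.vec) (some b)) := by
  refine Relation.ReflTransGen.tail hβ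
    (attaches_of_bond hS (hS ▸ hβ.stable) he hb (q := q) (by simp [hq]) ?_)
  rw [bond_add_vec_iff]
  exact ⟨a, b, extends_update he b q a hq, Function.update_self .., hg⟩

theorem exists_bond_of_stable_update {α : Assembly} {p : ℤ × ℤ} {pl : Placement}
    (hp : α p = none) (hne : (adom α).Nonempty)
    (hs : Stable (Function.update α p (some pl)) 1) :
    ∃ q, α q ≠ none ∧ 0 < bondStrength (Function.update α p (some pl)) q p := by
  rw [stable_one_iff, adom_update] at hs
  have hpα : p ∉ adom α := by simp [adom, hp]
  obtain ⟨a, ha, b, ⟨hb | hb, hbα⟩, hab⟩ := hs (adom α) (Set.subset_insert _ _) hne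
    ⟨p, Set.mem_insert _ _, hpα⟩
  · exact ⟨a, ha, hb ▸ hab⟩
  · exact absurd hb hbα

/-! ### Terminal assemblies -/

theorem extends_of_step {f : ℕ → Assembly} (hf : ∀ n, Extends (f n) (f (n + 1))) {m n : ℕ}
    (h : m ≤ n) : Extends (f m) (f n) := by
  induction h with
  | refl => exact fun _ _ h => h
  | step _ ih => exact ih.trans (hf _)

theorem exists_sequence_through {S : RTAS} {β : Assembly} (hβ : Reachable S β)
    (g : ℕ → Assembly) (h0 : g 0 = β) (hg : ∀ n, g (n + 1) = g n ∨ Attaches S (g n) (g (n + 1))) :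
    ∃ f : ℕ → Assembly, f 0 = S.seed ∧ (∀ n, f (n + 1) = f n ∨ Attaches S (f n) (f (n + 1))) ∧
      ∃ k, ∀ n, f (n + k) = g n := by
  unfold Reachable at hβ
  generalize S.seed = σ at hβ ⊢
  induction hβ using Relation.ReflTransGen.head_induction_on with
  | refl => exact ⟨g, h0, hg, 0, fun _ => rfl⟩
  | @head a _ h _ ih =>
    obtain ⟨f, hf0, hf, k, hk⟩ := ih
    refine ⟨fun n => Nat.casesOn (motive := fun _ => Assembly) n a f, rfl, ?_, k + 1, fun n => hk n⟩
    rintro (_ | n)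
    · right
      change Attaches S a (f 0)
      rwa [hf0]
    · exact hf n

open Classical in
/-- A fair continuation: attach some tile at the position `p` if this is possible. -/
noncomputable def tryAttach (S : RTAS) (p : ℤ × ℤ) (β : Assembly) : Assembly :=
  if h : ∃ γ, Attaches S β γ ∧ β p = none ∧ γ p ≠ none then h.choose else β

theorem tryAttach_step (S : RTAS) (p : ℤ × ℤ) (β : Assembly) :
    tryAttach S p β = β ∨ Attaches S β (tryAttach S p β) := by
  unfold tryAttach
  split_ifs with h
  · exact Or.inr h.choose_spec.1
  · exact Or.inl rfl

theorem tryAttach_ne_none {S : RTAS} {p : ℤ × ℤ} {β : Assembly}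
    (h : ∃ γ, Attaches S β γ ∧ β p = none ∧ γ p ≠ none) : tryAttach S p β p ≠ none := by
  unfold tryAttach
  rw [dif_pos h]
  exact h.choose_spec.2.2

theorem Producible.reachable_approx {S : RTAS} {α : Assembly} (h : Producible S α) :
    ∃ f : ℕ → Assembly, f 0 = S.seed ∧ (∀ n, f (n + 1) = f n ∨ Attaches S (f n) (f (n + 1))) ∧
      (∀ n, Reachable S (f n)) ∧ (∀ n, Extends (f n) α) ∧
      (∀ p pl, α p = some pl → ∃ n, f n p = some pl) := by
  obtain ⟨f, h0, hf, hα⟩ := h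
  refine ⟨f, h0, hf, fun n => ?_, fun n p pl hp => (hα p pl).2 ⟨n, hp⟩, fun p pl => (hα p pl).1⟩
  induction n with
  | zero => exact h0 ▸ Relation.ReflTransGen.refl
  | succ n ih =>
    rcases hf n with h | h
    · rwa [h]
    · exact Relation.ReflTransGen.tail ih h

theorem exists_terminal {S : RTAS} (hS : S.temp = 1) {β : Assembly} (hβ : Reachable S β) :
    ∃ γ, Terminal S γ ∧ Extends β γ := by
  classical
  obtain ⟨e, he⟩ := exists_surjective_nat (ℤ × ℤ)
  let g : ℕ → Assembly := fun n =>
    Nat.rec (motive := fun _ => Assembly) β (fun n b => tryAttach S (e n.unpair.1) b) n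
  have hg : ∀ n, g (n + 1) = tryAttach S (e n.unpair.1) (g n) := fun n => rfl
  have hstep : ∀ n, g (n + 1) = g n ∨ Attaches S (g n) (g (n + 1)) := fun n => tryAttach_step ..
  have hgext : ∀ n, Extends (g n) (g (n + 1)) := fun n => by
    rcases hstep n with h | h
    · rw [h]; exact fun _ _ h => h
    · exact h.extends
  have hreach : ∀ n, Reachable S (g n) := fun n => by
    induction n with
    | zero => exact hβ
    | succ n ih =>
      rcases hstep n with h | h
      · rwa [h]
      · exact Relation.ReflTransGen.tail ih h
  let γ : Assembly := fun p =>
    if h : ∃ n, g n p ≠ none then g (Exists.choose h) p else none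
  have hγ : ∀ p pl, γ p = some pl ↔ ∃ n, g n p = some pl := by
    intro p pl
    constructor
    · intro h
      simp only [γ] at h
      split_ifs at h with hn
      exact ⟨_, h⟩
    · rintro ⟨n, hn⟩
      have hex : ∃ n, g n p ≠ none := ⟨n, by simp [hn]⟩
      have : γ p = g hex.choose p := by simp only [γ, dif_pos hex]
      rw [this]
      obtain ⟨x, hx⟩ := Option.ne_none_iff_exists'.1 hex.choose_spec
      have h1 := extends_of_step hgext (le_max_left n hex.choose) _ _ hn
      have h2 := extends_of_step hgext (le_max_right n hex.choose) _ _ hx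
      rw [hx, ← h2, h1]
  have hgγ : ∀ n, Extends (g n) γ := fun n p pl hp => (hγ p pl).2 ⟨n, hp⟩
  obtain ⟨f, hf0, hf, k, hk⟩ := exists_sequence_through hβ g rfl hstep
  have hfext : ∀ n, Extends (f n) (f (n + 1)) := fun n => by
    rcases hf n with h | h
    · rw [h]; exact fun _ _ h => h
    · exact h.extends
  refine ⟨γ, ⟨⟨f, hf0, hf, fun p pl => (hγ p pl).trans ⟨?_, ?_⟩⟩, ?_⟩, hgγ 0⟩
  · rintro ⟨n, hn⟩
    exact ⟨n + k, by rw [hk, hn]⟩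
  · rintro ⟨n, hn⟩
    exact ⟨n, by rw [← hk]; exact extends_of_step hfext (Nat.le_add_right n k) _ _ hn⟩
  · rintro δ ⟨p, t, r, hp, ht, rfl, hs⟩
    have hne : (adom γ).Nonempty := by
      obtain ⟨q, hq⟩ := S.seed_nonempty
      obtain ⟨x, hx⟩ := Option.ne_none_iff_exists'.1 hq
      exact ⟨q, by simp [adom, hgγ 0 _ _ (hβ.extends_seed _ _ hx)]⟩
    obtain ⟨q, hq, hb⟩ := exists_bond_of_stable_update hp hne (hS ▸ hs)
    obtain ⟨x, hx⟩ := Option.ne_none_iff_exists'.1 hq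
    obtain ⟨m, hm⟩ := (hγ q x).1 hx
    obtain ⟨j, rfl⟩ := he p
    have hgm : g (Nat.pair j m) q = some x :=
      extends_of_step hgext (Nat.right_le_pair j m) _ _ hm
    have hempty : ∀ n, g n (e j) = none := fun n => by
      by_contra hn
      obtain ⟨y, hy⟩ := Option.ne_none_iff_exists'.1 hn
      simp [hgγ n _ _ hy] at hp
    refine tryAttach_ne_none (S := S) (p := e j) (β := g (Nat.pair j m))
      ⟨_, attaches_of_bond hS (pl := (t, r)) (hS ▸ (hreach _).stable) (hempty _) ht (q := q)
        (by simp [hgm]) ?_, hempty _, by simp⟩ ?_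
    · have hqp : q ≠ e j := by rintro h; simp [← h, hx] at hp
      simpa only [bondStrength, Function.update_self, Function.update_of_ne hqp, hx, hgm] using hb
    · have := hg (Nat.pair j m)
      rw [Nat.unpair_pair] at this
      rw [← this]
      exact hempty (Nat.pair j m + 1)

/-! ### Walks in the binding graph -/

/-- The displacement of a word of directions. -/
def disp (K : List Dir) : ℤ × ℤ := (K.map Dir.vec).sum

/-- The word `K`, read from `p`, follows bonds of `α`. -/
def BondWalk (α : Assembly) : ℤ × ℤ → List Dir → Prop
  | _, [] => True
  | p, d :: K => 0 < bondStrength α p (p + d.vec) ∧ BondWalk α (p + d.vec) K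

/-- The word `K` never reverses immediately. -/
def NonBacktracking (K : List Dir) : Prop := K.IsChain fun d e => e ≠ d.opp

@[simp] theorem disp_nil : disp [] = 0 := rfl

@[simp] theorem disp_cons (d : Dir) (K : List Dir) : disp (d :: K) = d.vec + disp K := by
  simp [disp]

@[simp] theorem disp_append (K L : List Dir) : disp (K ++ L) = disp K + disp L := by
  simp [disp]

theorem bondWalk_append (α : Assembly) (p : ℤ × ℤ) (K L : List Dir) :
    BondWalk α p (K ++ L) ↔ BondWalk α p K ∧ BondWalk α (p + disp K) L := by
  induction K generalizing p with
  | nil => simp [BondWalk]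
  | cons d K ih => simp [BondWalk, ih, add_assoc, and_assoc]

theorem BondWalk.mono {α β : Assembly} (h : Extends α β) {p : ℤ × ℤ} {K : List Dir}
    (hK : BondWalk α p K) : BondWalk β p K := by
  induction K generalizing p with
  | nil => trivial
  | cons d K ih => exact ⟨h.bond hK.1, ih hK.2⟩

theorem exists_walk_of_attaches {S : RTAS} (hS : S.temp = 1) {s : ℤ × ℤ} {α β : Assembly}
    (h : Attaches S α β) (hs : α s ≠ none)
    (hα : ∀ p, α p ≠ none → ∃ K, NonBacktracking K ∧ BondWalk α s K ∧ s + disp K = p) :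
    ∀ p, β p ≠ none → ∃ K, NonBacktracking K ∧ BondWalk β s K ∧ s + disp K = p := by
  have hext := h.extends
  obtain ⟨p, t, r, hp, ht, rfl, hst⟩ := h
  intro x hx
  by_cases hxp : x = p
  · subst hxp
    obtain ⟨q, hq, hb⟩ := exists_bond_of_stable_update hp ⟨s, hs⟩ (hS ▸ hst)
    obtain ⟨d, hd⟩ := exists_dir_of_bond hb
    obtain ⟨K, hK, hw, hqK⟩ := hα q hq
    refine ⟨K ++ [d], ?_, ?_, by simp [← add_assoc, hqK, hd]⟩
    · refine List.isChain_append.2 ⟨hK, List.isChain_singleton _, ?_⟩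
      intro e he d' hd' hde
      obtain rfl : d = d' := by simpa using hd'
      obtain ⟨L, rfl⟩ := List.getLast?_eq_some_iff.1 he
      rw [bondWalk_append] at hw
      obtain ⟨a, -, ha, -⟩ := exists_of_bond hw.2.1
      have : s + disp L = x := by
        rw [hd, ← hqK, hde, Dir.vec_opp]
        simp [add_assoc]
      simp [this, hp] at ha
    · rw [bondWalk_append]
      refine ⟨hw.mono hext, ?_, trivial⟩
      rw [hqK, ← hd]
      exact hb
  · rw [Function.update_of_ne hxp] at hx
    obtain ⟨K, hK, hw, hxK⟩ := hα x hx
    exact ⟨K, hK, hw.mono hext, hxK⟩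

theorem Reachable.exists_walk {S : RTAS} (hS : S.temp = 1) {s : ℤ × ℤ} (hs : adom S.seed = {s})
    {β : Assembly} (hβ : Reachable S β) :
    ∀ p, β p ≠ none → ∃ K, NonBacktracking K ∧ BondWalk β s K ∧ s + disp K = p := by
  have hseed : s ∈ adom S.seed := hs ▸ rfl
  obtain ⟨a, ha⟩ := Option.ne_none_iff_exists'.1 hseed
  induction hβ with
  | refl =>
    intro p hp
    obtain rfl : p = s := by
      have : p ∈ adom S.seed := hp
      rwa [hs] at this
    exact ⟨[], List.isChain_nil, trivial, by simp⟩
  | tail hα h ih =>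
    exact exists_walk_of_attaches hS h (by simp [Reachable.extends_seed hα _ _ ha]) ih

theorem Producible.exists_walk {S : RTAS} (hS : S.temp = 1) {s : ℤ × ℤ}
    (hs : adom S.seed = {s}) {α : Assembly} (hα : Producible S α) {p : ℤ × ℤ} {a : Placement}
    (hp : α p = some a) : ∃ K, NonBacktracking K ∧ BondWalk α s K ∧ s + disp K = p := by
  obtain ⟨f, -, -, hr, hext, hf⟩ := hα.reachable_approx
  obtain ⟨n, hn⟩ := hf p a hp
  obtain ⟨K, hK, hw, h⟩ := (hr n).exists_walk hS hs p (by simp [hn])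
  exact ⟨K, hK, hw.mono (hext n), h⟩

theorem Producible.tiles {S : RTAS} {α : Assembly} (hα : Producible S α) {p : ℤ × ℤ}
    {a : Placement} (hp : α p = some a) : a.1 ∈ S.tiles := by
  obtain ⟨f, -, -, hr, -, hf⟩ := hα.reachable_approx
  obtain ⟨n, hn⟩ := hf p a hp
  exact (hr n).tiles hn

/-! ### Unfolding walks monotonically -/

/-- The product order on `ℤ²` in which the quadrant `t` is positive. -/
def LeIn (t : Bool × Bool) (p q : ℤ × ℤ) : Prop :=
  sgn t.1 * p.1 ≤ sgn t.1 * q.1 ∧ sgn t.2 * p.2 ≤ sgn t.2 * q.2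

theorem LeIn.refl (t : Bool × Bool) (p : ℤ × ℤ) : LeIn t p p := ⟨le_rfl, le_rfl⟩

theorem LeIn.trans {t : Bool × Bool} {p q r : ℤ × ℤ} (h : LeIn t p q) (h' : LeIn t q r) :
    LeIn t p r := ⟨h.1.trans h'.1, h.2.trans h'.2⟩

theorem leIn_add_toward (t : Bool × Bool) (d : Dir) (p : ℤ × ℤ) :
    LeIn t p (p + (d.toward t).vec) := by
  obtain ⟨t1, t2⟩ := t
  obtain ⟨c, s⟩ := d
  cases t1 <;> cases t2 <;> cases c <;> simp [LeIn, Dir.toward, Dir.vec, sgn, signAt]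

theorem not_leIn_add_toward (t : Bool × Bool) (d : Dir) (p : ℤ × ℤ) :
    ¬ LeIn t (p + (d.toward t).vec) p := by
  obtain ⟨t1, t2⟩ := t
  obtain ⟨c, s⟩ := d
  cases t1 <;> cases t2 <;> cases c <;> simp [LeIn, Dir.toward, Dir.vec, sgn, signAt]

/-- A reflection presenting two given sides of a tile in prescribed directions. -/
theorem exists_reflection (t : Bool × Bool) (r : Reflection) (d e : Dir) (h : e ≠ d.opp) :
    ∃ r' : Reflection, r'.act (d.toward t).opp = r.act d.opp ∧ r'.act (e.toward t) = r.act e := by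
  revert t r d e
  decide

/-- Unfolding all but the last step of a walk into the quadrant `t`. -/
theorem grow_dropLast {S : RTAS} (hS : S.temp = 1) {α : Assembly}
    (hα : ∀ p a, α p = some a → a.1 ∈ S.tiles) (t : Bool × Bool) (d : Dir) (K : List Dir)
    {z q : ℤ × ℤ} {β : Assembly} {a : Placement} {r : Reflection} {h : Dir}
    (hβ : Reachable S β) (hw : BondWalk α z (K ++ [d])) (hK : NonBacktracking (K ++ [d]))
    (hz : α z = some a) (hq : β q = some (a.1, r)) (hh : (K ++ [d]).head? = some h)
    (hr : r.act (h.toward t) = Reflection.act a.2 h)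
    (he : ∀ p, LeIn t (q + (h.toward t).vec) p → β p = none) :
    ∃ (β' : Assembly) (b : Placement) (r' : Reflection), Reachable S β' ∧ Extends β β' ∧
      (∀ p, β' p ≠ none → β p ≠ none ∨ LeIn t (q + (h.toward t).vec) p ∧
        LeIn t p (q + disp (K.map (Dir.toward t)))) ∧
      LeIn t q (q + disp (K.map (Dir.toward t))) ∧
      LeIn t (q + (h.toward t).vec) (q + disp ((K ++ [d]).map (Dir.toward t))) ∧
      α (z + disp K) = some b ∧ β' (q + disp (K.map (Dir.toward t))) = some (b.1, r') ∧
      r'.act (d.toward t) = Reflection.act b.2 d := by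
  induction K generalizing z q β a r h with
  | nil =>
    obtain rfl : d = h := by simpa using hh
    exact ⟨β, a, r, hβ, fun _ _ h => h, fun p hp => Or.inl hp, by simpa using LeIn.refl t q,
      by simpa using LeIn.refl t _, by simpa using hz, by simpa using hq, hr⟩
  | cons e K ih =>
    obtain rfl : e = h := by simpa using hh
    obtain ⟨h', hh'⟩ : ∃ h', (K ++ [d]).head? = some h' := by
      cases K <;> simp
    obtain ⟨hb, hw'⟩ := hw
    obtain ⟨a', b, ha', hzb, hg⟩ := (bond_add_vec_iff ..).1 hb
    obtain rfl : a = a' := by simpa [hz] using ha'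
    rw [List.cons_append] at hK
    obtain ⟨hne, hK'⟩ := List.isChain_cons.1 hK
    obtain ⟨r', hr1, hr2⟩ := exists_reflection t b.2 e h' (hne h' hh')
    have hβ' := hβ.attach hS (d := e.toward t) (b := (b.1, r')) hq (he _ (LeIn.refl _ _))
      (show b.1 ∈ S.tiles from hα _ _ hzb) (by simpa only [glueAt, hr, hr1] using hg)
    have hext := extends_update (he _ (LeIn.refl t _)) (b.1, r')
    obtain ⟨β', c, r'', h1, h2, h3, h4, h5, h6, h7, h8⟩ := ih hβ' hw' hK' hzb
      (Function.update_self ..) hh' hr2 (fun p hp => by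
        rw [Function.update_of_ne, he p ((leIn_add_toward t h' _).trans hp)]
        rintro rfl
        exact not_leIn_add_toward _ _ _ hp)
    simp only [List.cons_append, List.map_cons, disp_cons, ← add_assoc]
    refine ⟨β', c, r'', h1, hext.trans h2, fun p hp => ?_, (leIn_add_toward t e q).trans h4,
      (leIn_add_toward t h' _).trans h5, h6, h7, h8⟩
    rcases h3 p hp with h | h
    · by_cases hpq : p = q + (e.toward t).vec
      · exact Or.inr ⟨hpq ▸ LeIn.refl _ _, hpq ▸ h4⟩
      · rw [Function.update_of_ne hpq] at h
        exact Or.inl h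
    · exact Or.inr ⟨(leIn_add_toward t h' _).trans h.1, h.2⟩

/-- Attaching the last tile of an unfolded walk, in any reflection presenting the input side
correctly. -/
theorem grow_last {S : RTAS} (hS : S.temp = 1) {α : Assembly}
    (hα : ∀ p a, α p = some a → a.1 ∈ S.tiles) (t : Bool × Bool) (d : Dir) (K : List Dir)
    {z q : ℤ × ℤ} {β : Assembly} {a : Placement} {r : Reflection} {h : Dir}
    (hβ : Reachable S β) (hw : BondWalk α z (K ++ [d])) (hK : NonBacktracking (K ++ [d]))
    (hz : α z = some a) (hq : β q = some (a.1, r)) (hh : (K ++ [d]).head? = some h)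
    (hr : r.act (h.toward t) = Reflection.act a.2 h)
    (he : ∀ p, LeIn t (q + (h.toward t).vec) p → β p = none) :
    ∃ b, α (z + disp (K ++ [d])) = some b ∧
      ∀ r' : Reflection, r'.act (d.toward t).opp = Reflection.act b.2 d.opp →
        ∃ β' : Assembly, Reachable S β' ∧ Extends β β' ∧
          (∀ p, β' p ≠ none → β p ≠ none ∨ LeIn t (q + (h.toward t).vec) p) ∧
          (∀ p, β' p ≠ none → (β p ≠ none ∧ p ≠ q) ∨
            p = q + disp ((K ++ [d]).map (Dir.toward t)) ∨
            LeIn t p (q + disp (K.map (Dir.toward t)))) ∧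
          β' (q + disp ((K ++ [d]).map (Dir.toward t))) = some (b.1, r') := by
  obtain ⟨β', c, r₁, h1, h2, h3, h4, h5, h6, h7, h8⟩ :=
    grow_dropLast hS hα t d K hβ hw hK hz hq hh hr he
  obtain ⟨-, hb, -⟩ := (bondWalk_append ..).1 hw
  obtain ⟨c', b, hc', hzb, hg⟩ := (bond_add_vec_iff ..).1 hb
  obtain rfl : c = c' := by simpa [h6] using hc'
  refine ⟨b, by simpa [← add_assoc] using hzb, fun r' hr' => ?_⟩
  have hend : q + disp ((K ++ [d]).map (Dir.toward t)) =
      q + disp (K.map (Dir.toward t)) + (d.toward t).vec := by simp [add_assoc]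
  rw [hend] at h5 ⊢
  have hempty : β' (q + disp (K.map (Dir.toward t)) + (d.toward t).vec) = none := by
    by_contra hne
    rcases h3 _ hne with h | h
    · exact h (he _ h5)
    · exact not_leIn_add_toward _ _ _ h.2
  refine ⟨_, h1.attach hS (b := (b.1, r')) h7 hempty
    (show b.1 ∈ S.tiles from hα _ _ hzb)
    (by simpa only [glueAt, h8, hr'] using hg), h2.trans (extends_update hempty _),
    fun p hp => ?_, fun p hp => ?_, Function.update_self ..⟩
  · by_cases hpe : p = q + disp (K.map (Dir.toward t)) + (d.toward t).vec
    · exact Or.inr (hpe ▸ h5)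
    · rw [Function.update_of_ne hpe] at hp
      exact (h3 p hp).imp_right And.left
  · by_cases hpe : p = q + disp (K.map (Dir.toward t)) + (d.toward t).vec
    · exact Or.inr (Or.inl hpe)
    · rw [Function.update_of_ne hpe] at hp
      rcases h3 p hp with h | h
      · by_cases hpq : p = q
        · exact Or.inr (Or.inr (hpq ▸ h4))
        · exact Or.inl ⟨h, hpq⟩
      · exact Or.inr (Or.inr h.2)

theorem Dir.ne_opp (d : Dir) : d ≠ d.opp := by
  revert d; decide

theorem exists_toward_eq (h : Dir) : ∃ t : Bool × Bool, h.toward t = h := by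
  revert h; decide

/-- Unfolding a possibly empty walk whose first step, if any, is `h`. -/
theorem grow {S : RTAS} (hS : S.temp = 1) {α : Assembly}
    (hα : ∀ p a, α p = some a → a.1 ∈ S.tiles) (t : Bool × Bool) (K : List Dir)
    {z q : ℤ × ℤ} {β : Assembly} {a : Placement} {r : Reflection} {h : Dir}
    (hβ : Reachable S β) (hw : BondWalk α z K) (hK : NonBacktracking K)
    (hz : α z = some a) (hq : β q = some (a.1, r)) (hh : ∀ h', K.head? = some h' → h' = h)
    (hr : r.act (h.toward t) = Reflection.act a.2 h)
    (he : ∀ p, LeIn t (q + (h.toward t).vec) p → β p = none) :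
    ∃ (β' : Assembly) (b : Placement) (r' : Reflection), Reachable S β' ∧ Extends β β' ∧
      (∀ p, β' p ≠ none → β p ≠ none ∨ LeIn t (q + (h.toward t).vec) p) ∧
      α (z + disp K) = some b ∧ β' (q + disp (K.map (Dir.toward t))) = some (b.1, r') := by
  rcases List.eq_nil_or_concat K with rfl | ⟨L, d, rfl⟩
  · exact ⟨β, a, r, hβ, fun _ _ h => h, fun _ hp => Or.inl hp, by simpa using hz,
      by simpa using hq⟩
  · rw [List.concat_eq_append] at *
    obtain ⟨h', hh'⟩ : ∃ h', (L ++ [d]).head? = some h' := by cases L <;> simp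
    obtain rfl := hh h' hh'
    obtain ⟨b, hb, hgrow⟩ := grow_last hS hα t d L hβ hw hK hz hq hh' hr he
    obtain ⟨r', hr', -⟩ := exists_reflection t b.2 d d d.ne_opp
    obtain ⟨β', h1, h2, h3, -, h4⟩ := hgrow r' hr'
    exact ⟨β', b, r', h1, h2, h3, hb, h4⟩

/-- The unfolded branches with first steps `e`, `f` into the quadrants `p`, `q` are separated by
a line. -/
def Separated (p : Bool × Bool) (e : Dir) (q : Bool × Bool) (f : Dir) : Prop :=
  ∃ c, signAt p c ≠ signAt q c ∧ (e.1 = c ∨ f.1 = c)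

instance (p : Bool × Bool) (e : Dir) (q : Bool × Bool) (f : Dir) :
    Decidable (Separated p e q f) := by
  unfold Separated; infer_instance

theorem Separated.not_leIn {p q : Bool × Bool} {e f : Dir} (h : Separated p e q f)
    {w x : ℤ × ℤ} (he : LeIn p (w + (e.toward p).vec) x)
    (hf : LeIn q (w + (f.toward q).vec) x) : False := by
  obtain ⟨c, hc, hef⟩ := h
  obtain ⟨p1, p2⟩ := p
  obtain ⟨q1, q2⟩ := q
  obtain ⟨e1, e2⟩ := e
  obtain ⟨f1, f2⟩ := f
  obtain ⟨w1, w2⟩ := w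
  obtain ⟨x1, x2⟩ := x
  cases p1 <;> cases p2 <;> cases q1 <;> cases q2 <;> cases c <;>
    simp [signAt] at hc <;> cases e1 <;> cases f1 <;>
    simp [LeIn, Dir.toward, Dir.vec, sgn, signAt] at he hf hef <;> omega

theorem leIn_opp {t : Bool × Bool} {d : Dir} {x w : ℤ × ℤ} (h : LeIn t x w) :
    LeIn (!t.1, !t.2) (w + (d.toward t).vec + (d.opp.toward (!t.1, !t.2)).vec) x := by
  obtain ⟨t1, t2⟩ := t
  obtain ⟨c, s⟩ := d
  cases t1 <;> cases t2 <;> cases c <;>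
    simp_all [LeIn, Dir.toward, Dir.vec, sgn, signAt, Dir.opp]

theorem act_comp (r s : Reflection) (d : Dir) :
    Reflection.act (Reflection.comp s r) d = r.act (s.act d) := by
  revert r s d
  decide

theorem exists_quadrants (e f : Dir) (c : Bool) (h : e ≠ f) :
    ∃ p q : Bool × Bool, e.toward p = e ∧ f.toward q = f ∧ Separated p e q f ∧
      signAt p c ≠ signAt q c := by
  revert e f c
  decide +kernel

theorem exists_quadrants_after (t : Bool × Bool) (d e f : Dir) (c : Bool) (h : e ≠ f)
    (he : e ≠ d.opp) (hf : f ≠ d.opp) :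
    ∃ (s : Reflection) (p q : Bool × Bool), s.act (d.toward t).opp = d.opp ∧
      s.act (e.toward p) = e ∧ s.act (f.toward q) = f ∧ Separated p e q f ∧
      Separated p e (!t.1, !t.2) d.opp ∧ Separated q f (!t.1, !t.2) d.opp ∧
      signAt p c ≠ signAt q c := by
  revert t d e f c
  decide +kernel

theorem exists_heads (x y o : Option Dir) (hxy : ∀ h, x = some h → y ≠ some h)
    (ho : ∀ d : Dir, o = some d → x ≠ some d.opp ∧ y ≠ some d.opp) :
    ∃ e f : Dir, e ≠ f ∧ (∀ h, x = some h → h = e) ∧ (∀ h, y = some h → h = f) ∧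
      ∀ d : Dir, o = some d → e ≠ d.opp ∧ f ≠ d.opp := by
  rcases x with _ | x <;> rcases y with _ | y <;> rcases o with _ | o <;>
    simp only [reduceCtorEq, Option.some.injEq, ne_eq, not_false_eq_true, false_implies,
      implies_true, true_and, and_true, forall_eq'] at hxy ho ⊢
  all_goals
    try revert o
    try revert y
    try revert x
    decide +kernel

/-- Unfolding two branches leaving the same tile. -/
theorem grow_two {S : RTAS} (hS : S.temp = 1) {α : Assembly}
    (hα : ∀ p a, α p = some a → a.1 ∈ S.tiles) {p q : Bool × Bool} {P Q : List Dir}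
    {z w : ℤ × ℤ} {β : Assembly} {a : Placement} {r : Reflection} {e f : Dir}
    (hβ : Reachable S β) (hz : α z = some a) (hw : β w = some (a.1, r))
    (hPw : BondWalk α z P) (hP : NonBacktracking P) (hPe : ∀ h, P.head? = some h → h = e)
    (hre : r.act (e.toward p) = Reflection.act a.2 e)
    (he : ∀ x, LeIn p (w + (e.toward p).vec) x → β x = none)
    (hQw : BondWalk α z Q) (hQ : NonBacktracking Q) (hQf : ∀ h, Q.head? = some h → h = f)
    (hrf : r.act (f.toward q) = Reflection.act a.2 f)
    (hf : ∀ x, LeIn q (w + (f.toward q).vec) x → β x = none) (hsep : Separated p e q f) :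
    ∃ (β' : Assembly) (b b' : Placement) (r₁ r₂ : Reflection), Reachable S β' ∧
      α (z + disp P) = some b ∧ β' (w + disp (P.map (Dir.toward p))) = some (b.1, r₁) ∧
      α (z + disp Q) = some b' ∧ β' (w + disp (Q.map (Dir.toward q))) = some (b'.1, r₂) := by
  obtain ⟨β₁, b, r₁, h1, h2, h3, h4, h5⟩ := grow hS hα p P hβ hPw hP hz hw hPe hre he
  obtain ⟨β₂, b', r₂, k1, k2, -, k4, k5⟩ := grow hS hα q Q h1 hQw hQ hz (h2 _ _ hw) hQf hrf
    (fun x hx => by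
      by_contra hne
      rcases h3 x hne with h | h
      · exact h (hf x hx)
      · exact hsep.not_leIn h hx)
  exact ⟨β₂, b, b', r₁, r₂, k1, h4, k2 _ _ h5, k4, k5⟩

/-- Two walks from the seed can be unfolded so that, beyond their common prefix, they run in
opposite directions along the axis `c`. -/
theorem exists_opposite_unfolding {S : RTAS} (hS : S.temp = 1) {s : ℤ × ℤ}
    (hs : adom S.seed = {s}) {α : Assembly} (hext : Extends S.seed α)
    (hα : ∀ p a, α p = some a → a.1 ∈ S.tiles) {W P Q : List Dir}
    (hP : NonBacktracking (W ++ P)) (hQ : NonBacktracking (W ++ Q))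
    (hPw : BondWalk α s (W ++ P)) (hQw : BondWalk α s (W ++ Q))
    (hPQ : ∀ h, P.head? = some h → Q.head? ≠ some h) (c : Bool) :
    ∃ (β : Assembly) (w : ℤ × ℤ) (p q : Bool × Bool) (b b' : Placement) (r₁ r₂ : Reflection),
      Reachable S β ∧ signAt p c ≠ signAt q c ∧
      α (s + disp (W ++ P)) = some b ∧ β (w + disp (P.map (Dir.toward p))) = some (b.1, r₁) ∧
      α (s + disp (W ++ Q)) = some b' ∧
      β (w + disp (Q.map (Dir.toward q))) = some (b'.1, r₂) := by
  have hseed : ∀ p, S.seed p ≠ none ↔ p = s := fun p => by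
    change p ∈ adom S.seed ↔ _
    rw [hs]; rfl
  obtain ⟨a, ha⟩ := Option.ne_none_iff_exists'.1 ((hseed s).2 rfl)
  have hseedα := hext _ _ ha
  obtain ⟨hP1, hP2, hP3⟩ := List.isChain_append.1 hP
  obtain ⟨-, hQ2, hQ3⟩ := List.isChain_append.1 hQ
  obtain ⟨e, f, hef, hPe, hQf, hlast⟩ := exists_heads P.head? Q.head? W.getLast? hPQ
    fun d hd => ⟨fun h => hP3 d hd _ h rfl, fun h => hQ3 d hd _ h rfl⟩
  rw [bondWalk_append] at hPw hQw
  rcases List.eq_nil_or_concat W with rfl | ⟨L, d, rfl⟩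
  · obtain ⟨p, q, hpe, hqf, hsep, hpq⟩ := exists_quadrants e f c hef
    have hempty : ∀ (t : Bool × Bool) (d : Dir) (x : ℤ × ℤ),
        LeIn t (s + (d.toward t).vec) x → S.seed x = none := by
      intro t d x hx
      by_contra hne
      rw [(hseed x).1 hne] at hx
      exact not_leIn_add_toward _ _ _ hx
    obtain ⟨β, b, b', r₁, r₂, h1, h2, h3, h4, h5⟩ := grow_two hS hα (a := a) (r := a.2)
      Relation.ReflTransGen.refl hseedα ha (by simpa using hPw.2) hP2 hPe (by rw [hpe])
      (hempty p e) (by simpa using hQw.2) hQ2 hQf (by rw [hqf]) (hempty q f) hsep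
    exact ⟨β, s, p, q, b, b', r₁, r₂, h1, hpq, h2, h3, h4, h5⟩
  · rw [List.concat_eq_append] at *
    obtain ⟨he, hf⟩ := hlast d (by simp)
    obtain ⟨h, hh⟩ : ∃ h, (L ++ [d]).head? = some h := by cases L <;> simp
    obtain ⟨t, ht⟩ := exists_toward_eq h
    obtain ⟨b, hb, hgrow⟩ := grow_last hS hα t d L (r := a.2) Relation.ReflTransGen.refl hPw.1
      hP1 hseedα ha hh (by rw [ht]) (fun x hx => by
        by_contra hne
        rw [(hseed x).1 hne] at hx
        exact not_leIn_add_toward _ _ _ hx)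
    obtain ⟨σ, p, q, h1, h2, h3, hsep, hsp, hsq, hpq⟩ :=
      exists_quadrants_after t d e f c hef he hf
    obtain ⟨β, k1, -, -, k2, k3⟩ := hgrow (Reflection.comp σ b.2) (by rw [act_comp, h1])
    have hend : s + disp ((L ++ [d]).map (Dir.toward t)) =
        s + disp (L.map (Dir.toward t)) + (d.toward t).vec := by simp [add_assoc]
    rw [hend] at k2 k3
    have hempty : ∀ (p : Bool × Bool) (e : Dir), Separated p e (!t.1, !t.2) d.opp →
        ∀ x, LeIn p (s + disp (L.map (Dir.toward t)) + (d.toward t).vec + (e.toward p).vec) x →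
        β x = none := by
      intro p e hsep x hx
      by_contra hne
      rcases k2 x hne with h | rfl | h
      · exact h.2 ((hseed x).1 h.1)
      · exact not_leIn_add_toward _ _ _ hx
      · exact hsep.not_leIn hx (leIn_opp h)
    obtain ⟨β', b₁, b₂, r₁, r₂, l1, l2, l3, l4, l5⟩ := grow_two hS hα k1 hb k3 hPw.2 hP2 hPe
      (by rw [act_comp, h2]) (hempty p e hsp) hQw.2 hQ2 hQf (by rw [act_comp, h3])
      (hempty q f hsq) hsep
    exact ⟨β', _, p, q, b₁, b₂, r₁, r₂, l1, hpq, by rwa [disp_append, ← add_assoc], l3,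
      by rwa [disp_append, ← add_assoc], l5⟩

/-! ### Counting steps -/

/-- The number of steps along the axis `c`. -/
def steps (c : Bool) (K : List Dir) : ℕ := K.countP fun d => d.1 == c

theorem coord_add (c : Bool) (p q : ℤ × ℤ) : coord c (p + q) = coord c p + coord c q := by
  cases c <;> rfl

theorem coord_disp_toward (c : Bool) (t : Bool × Bool) (K : List Dir) :
    coord c (disp (K.map (Dir.toward t))) = sgn (signAt t c) * steps c K := by
  induction K with
  | nil => cases c <;> simp [coord, steps]
  | cons d K ih =>
    rw [List.map_cons, disp_cons, coord_add, ih]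
    obtain ⟨x, y⟩ := d
    cases x <;> cases c <;> simp [steps, coord, Dir.toward, Dir.vec, signAt] <;> ring

theorem coord_disp_bounds (c : Bool) (K : List Dir) :
    |coord c (disp K)| ≤ steps c K ∧ (coord c (disp K) - steps c K) % 2 = 0 := by
  induction K with
  | nil => cases c <;> simp [coord, steps]
  | cons d K ih =>
    rw [disp_cons, coord_add]
    rw [abs_le] at ih ⊢
    obtain ⟨x, y⟩ := d
    cases x <;> cases y <;> cases c <;>
      simp [steps, coord, Dir.vec, sgn] at ih ⊢ <;> omega

theorem length_eq_steps (K : List Dir) : K.length = steps false K + steps true K := by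
  induction K with
  | nil => rfl
  | cons d K ih =>
    obtain ⟨x, y⟩ := d
    cases x <;> simp [steps] at ih ⊢ <;> omega

/-- The length of the longest common prefix of two words. -/
def lcp : List Dir → List Dir → ℕ
  | a :: K, b :: L => if a = b then lcp K L + 1 else 0
  | _, _ => 0

theorem lcp_comm (K L : List Dir) : lcp K L = lcp L K := by
  induction K generalizing L with
  | nil => cases L <;> rfl
  | cons a K ih =>
    cases L with
    | nil => rfl
    | cons b L => simp only [lcp, ih L, eq_comm]

theorem min_lcp_le (K L M : List Dir) : min (lcp K L) (lcp L M) ≤ lcp K M := by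
  induction K generalizing L M with
  | nil => cases L <;> simp [lcp]
  | cons a K ih =>
    cases L with
    | nil => simp [lcp]
    | cons b L =>
      cases M with
      | nil => simp [lcp]
      | cons c M =>
        have := ih L M
        simp only [lcp]
        split_ifs <;> first | omega | simp_all

theorem exists_eq_append_of_lcp (K L : List Dir) : ∃ W P Q, K = W ++ P ∧ L = W ++ Q ∧
    W.length = lcp K L ∧ ∀ h, P.head? = some h → Q.head? ≠ some h := by
  induction K generalizing L with
  | nil => exact ⟨[], [], L, rfl, rfl, by simp [lcp], by simp⟩
  | cons a K ih =>
    cases L with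
    | nil => exact ⟨[], a :: K, [], rfl, rfl, by simp [lcp], by simp⟩
    | cons b L =>
      by_cases hab : a = b
      · obtain ⟨W, P, Q, rfl, rfl, h, h'⟩ := ih L
        exact ⟨a :: W, P, Q, rfl, by simp [hab], by simp [lcp, hab, h], h'⟩
      · refine ⟨[], a :: K, b :: L, rfl, rfl, by simp [lcp, hab], ?_⟩
        simpa using Ne.symm hab

/-! ### Squares -/

/-- In every terminal assembly, the tiles with type in `B` form an `n × n` square. -/
def MarksSquare (S : RTAS) (B : Finset TileType) (n : ℕ) : Prop :=
  ∀ α, Terminal S α → ∃ (r : Reflection) (v : ℤ × ℤ),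
    {p | ∃ pl, transform α r v p = some pl ∧ pl.1 ∈ B} = squareShape n

theorem onPoint_onPoint (r : Reflection) (p : ℤ × ℤ) : r.onPoint (r.onPoint p) = p := by
  obtain ⟨r1, r2⟩ := r
  cases r1 <;> cases r2 <;> simp [Reflection.onPoint]

theorem MarksSquare.coord_sub_lt {S : RTAS} {B : Finset TileType} {n : ℕ}
    (hB : MarksSquare S B n) {α : Assembly} (hα : Terminal S α) {p q : ℤ × ℤ} {a b : Placement}
    (hp : α p = some a) (ha : a.1 ∈ B) (hq : α q = some b) (hb : b.1 ∈ B) (c : Bool) :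
    |coord c p - coord c q| < n := by
  obtain ⟨r, v, h⟩ := hB α hα
  have key : ∀ (x : ℤ × ℤ) (y : Placement), α x = some y → y.1 ∈ B →
      r.onPoint x + v ∈ squareShape n := by
    intro x y hx hy
    rw [← h]
    exact ⟨(y.1, Reflection.comp r y.2), by simp [transform, onPoint_onPoint, hx], hy⟩
  have h1 := key p a hp ha
  have h2 := key q b hq hb
  obtain ⟨r1, r2⟩ := r
  rw [abs_lt]
  cases r1 <;> cases r2 <;> cases c <;>
    simp [Reflection.onPoint, squareShape, rectShape, coord] at h1 h2 ⊢ <;> omega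

theorem MarksSquare.steps_lt {S : RTAS} (hS : S.temp = 1) {s : ℤ × ℤ} (hs : adom S.seed = {s})
    {B : Finset TileType} {n : ℕ} (hB : MarksSquare S B n) {α : Assembly}
    (hext : Extends S.seed α) (hα : ∀ p a, α p = some a → a.1 ∈ S.tiles) {W P Q : List Dir}
    (hP : NonBacktracking (W ++ P)) (hQ : NonBacktracking (W ++ Q))
    (hPw : BondWalk α s (W ++ P)) (hQw : BondWalk α s (W ++ Q))
    (hPQ : ∀ h, P.head? = some h → Q.head? ≠ some h) {a b : Placement}
    (ha : α (s + disp (W ++ P)) = some a) (haB : a.1 ∈ B)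
    (hb : α (s + disp (W ++ Q)) = some b) (hbB : b.1 ∈ B) (c : Bool) :
    steps c P + steps c Q < n := by
  obtain ⟨β, w, p, q, a', b', r₁, r₂, h1, hpq, h2, h3, h4, h5⟩ :=
    exists_opposite_unfolding hS hs hext hα hP hQ hPw hQw hPQ c
  obtain rfl := Option.some.inj (ha.symm.trans h2)
  obtain rfl := Option.some.inj (hb.symm.trans h4)
  obtain ⟨γ, hγ, hβγ⟩ := exists_terminal hS h1
  have := hB.coord_sub_lt hγ (hβγ _ _ h3) haB (hβγ _ _ h5) hbB c
  rw [coord_add, coord_add, coord_disp_toward, coord_disp_toward, abs_lt] at this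
  cases hp : signAt p c <;> cases hq : signAt q c <;> simp [hp, hq] at hpq <;>
    simp [hp, hq, sgn] at this <;> omega

/-- The distance between the ends of two words in the tree of words. -/
def wordDist (K L : List Dir) : ℤ := K.length + L.length - 2 * lcp K L

theorem wordDist_append {W P Q : List Dir} (h : W.length = lcp (W ++ P) (W ++ Q)) :
    wordDist (W ++ P) (W ++ Q) = (steps false P + steps true P) +
      (steps false Q + steps true Q) := by
  rw [wordDist, ← h, List.length_append, List.length_append, length_eq_steps P, length_eq_steps Q]
  push_cast
  ring

theorem abs_coord_sub_le_wordDist (K L : List Dir) :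
    |coord false (disp K) - coord false (disp L)| + |coord true (disp K) - coord true (disp L)| ≤
      wordDist K L := by
  obtain ⟨W, P, Q, rfl, rfl, h, -⟩ := exists_eq_append_of_lcp K L
  rw [wordDist_append h]
  simp only [disp_append, coord_add, add_sub_add_left_eq_sub]
  have h1 := abs_sub (coord false (disp P)) (coord false (disp Q))
  have h2 := abs_sub (coord true (disp P)) (coord true (disp Q))
  linarith [(coord_disp_bounds false P).1, (coord_disp_bounds false Q).1,
    (coord_disp_bounds true P).1, (coord_disp_bounds true Q).1]

theorem MarksSquare.wordDist_lt {S : RTAS} (hS : S.temp = 1) {s : ℤ × ℤ}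
    (hs : adom S.seed = {s}) {B : Finset TileType} {n : ℕ} (hn : Even n)
    (hB : MarksSquare S B n) {α : Assembly} (hext : Extends S.seed α)
    (hα : ∀ p a, α p = some a → a.1 ∈ S.tiles) {K L : List Dir}
    (hK : NonBacktracking K) (hL : NonBacktracking L)
    (hKw : BondWalk α s K) (hLw : BondWalk α s L) {a b : Placement}
    (ha : α (s + disp K) = some a) (haB : a.1 ∈ B)
    (hb : α (s + disp L) = some b) (hbB : b.1 ∈ B) (c : Bool)
    (hc : coord c (disp K) = coord c (disp L)) : wordDist K L < 2 * n - 2 := by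
  obtain ⟨W, P, Q, rfl, rfl, h, hPQ⟩ := exists_eq_append_of_lcp K L
  rw [wordDist_append h]
  have key := hB.steps_lt hS hs hext hα hK hL hKw hLw hPQ ha haB hb hbB
  have h1 := key false
  have h2 := key true
  have h3 := (coord_disp_bounds c P).2
  have h4 := (coord_disp_bounds c Q).2
  simp only [disp_append, coord_add, add_right_inj] at hc
  obtain ⟨m, rfl⟩ := hn
  cases c <;> omega

theorem four_point (K₁ K₂ K₃ K₄ : List Dir) : wordDist K₁ K₄ + wordDist K₂ K₃ ≤
    max (wordDist K₁ K₂ + wordDist K₃ K₄) (wordDist K₁ K₃ + wordDist K₂ K₄) := by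
  have h1 := min_lcp_le K₁ K₂ K₄
  have h2 := min_lcp_le K₁ K₃ K₄
  have h3 := min_lcp_le K₂ K₁ K₃
  have h4 := min_lcp_le K₂ K₄ K₃
  have h5 := min_lcp_le K₁ K₄ K₂
  have h6 := min_lcp_le K₁ K₄ K₃
  rw [lcp_comm K₂ K₁] at h3
  rw [lcp_comm K₄ K₃] at h4
  rw [lcp_comm K₄ K₂] at h5
  rw [lcp_comm K₄ K₃] at h6
  unfold wordDist
  omega

theorem not_marksSquare {S : RTAS} (hS : S.temp = 1) (hseed : SinglySeeded S)
    {B : Finset TileType} {n : ℕ} (hn : 0 < n) (he : Even n) : ¬ MarksSquare S B n := by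
  intro hB
  obtain ⟨s, hs⟩ := hseed
  obtain ⟨α, hα, hext⟩ := exists_terminal hS (Relation.ReflTransGen.refl : Reachable S S.seed)
  have hαt : ∀ p a, α p = some a → a.1 ∈ S.tiles := fun p a => hα.1.tiles
  obtain ⟨r, v, hsq⟩ := hB α hα
  have corner : ∀ i j : Bool, ∃ (K : List Dir) (a : Placement), NonBacktracking K ∧
      BondWalk α s K ∧ α (s + disp K) = some a ∧ a.1 ∈ B ∧
      s + disp K =
        r.onPoint (((if i then (n : ℤ) - 1 else 0, if j then (n : ℤ) - 1 else 0) : ℤ × ℤ) - v) := by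
    intro i j
    have hmem : ((if i then (n : ℤ) - 1 else 0, if j then (n : ℤ) - 1 else 0) : ℤ × ℤ) ∈
        squareShape n := by
      cases i <;> cases j <;> simp [squareShape, rectShape] <;> omega
    rw [← hsq] at hmem
    obtain ⟨pl, hpl, hplB⟩ := hmem
    obtain ⟨a, ha, rfl⟩ := Option.map_eq_some_iff.1 hpl
    obtain ⟨K, hK, hw, hd⟩ := hα.1.exists_walk hS hs ha
    exact ⟨K, a, hK, hw, hd ▸ ha, hplB, hd⟩
  choose K a hK hw ha haB hpos using corner
  have hlt : ∀ (i j i' j' c : Bool), coord c (s + disp (K i j)) = coord c (s + disp (K i' j')) →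
      wordDist (K i j) (K i' j') < 2 * n - 2 := fun i j i' j' c h =>
    hB.wordDist_lt hS hs he hext hαt (hK i j) (hK i' j') (hw i j) (hw i' j') (ha i j) (haB i j)
      (ha i' j') (haB i' j') c (by simpa only [coord_add, add_right_inj] using h)
  have hge : ∀ i j : Bool, 2 * (n : ℤ) - 2 ≤ wordDist (K i j) (K (!i) (!j)) := by
    intro i j
    refine le_trans ?_ (abs_coord_sub_le_wordDist _ _)
    have h (c : Bool) : coord c (disp (K i j)) - coord c (disp (K (!i) (!j))) =
        coord c (s + disp (K i j)) - coord c (s + disp (K (!i) (!j))) := by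
      simp [coord_add]
    rw [h, h, hpos, hpos]
    obtain ⟨r1, r2⟩ := r
    cases i <;> cases j <;> cases r1 <;> cases r2 <;>
      simp [Reflection.onPoint, coord] <;> grind
  have hx : ∀ i j j', coord false (s + disp (K i j)) = coord false (s + disp (K i j')) := by
    intro i j j'
    simp [hpos, Reflection.onPoint, coord]
  have hy : ∀ i i' j, coord true (s + disp (K i j)) = coord true (s + disp (K i' j)) := by
    intro i i' j
    simp [hpos, Reflection.onPoint, coord]
  have h1 := hlt _ _ _ _ _ (hx false false true)
  have h2 := hlt _ _ _ _ _ (hx true false true)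
  have h3 := hlt _ _ _ _ _ (hy false true false)
  have h4 := hlt _ _ _ _ _ (hy false true true)
  have h5 := hge false false
  have h6 := hge false true
  have h7 := four_point (K false false) (K false true) (K true false) (K true true)
  simp only [Bool.not_false, Bool.not_true] at h5 h6
  omega

theorem StrictlySelfAssembles.marksSquare {S : RTAS} {n : ℕ}
    (h : StrictlySelfAssembles S (squareShape n)) : MarksSquare S S.tiles n := by
  intro α hα
  obtain ⟨r, v, hr⟩ := h α hα
  refine ⟨r, v, hr ▸ ?_⟩
  ext p
  constructor
  · rintro ⟨pl, hpl, -⟩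
    simp [adom, hpl]
  · intro hp
    obtain ⟨pl, hpl⟩ := Option.ne_none_iff_exists'.1 hp
    obtain ⟨a, ha, rfl⟩ := Option.map_eq_some_iff.1 hpl
    exact ⟨_, hpl, show a.1 ∈ S.tiles from hα.1.tiles ha⟩

/-- For every even `n ∈ ℤ⁺`, no singly seeded temperature-1 RTAM system
weakly (or strictly) self-assembles an `n × n` square. -/
theorem rtam_no_even_square
    (n : ℕ) (hn : 0 < n) (he : Even n) :
    ¬ ∃ Sys : RTAS, Sys.temp = 1 ∧ SinglySeeded Sys ∧
      (WeaklySelfAssembles Sys (squareShape n) ∨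
        StrictlySelfAssembles Sys (squareShape n)) := by
  rintro ⟨S, hS, hseed, ⟨B, -, hB⟩ | h⟩
  · exact not_marksSquare hS hseed hn he hB
  · exact not_marksSquare hS hseed hn he h.marksSquare
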